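/- arXiv:1801.03787 — 2 statements merged into one kernel-verified Lean document; each statement's English description precedes it below -/
import Mathlib

section
/- Let B₁(0) ⊂ ℝ² be the open unit disk, x₀ ∈ ∂B₁(0), α ∈ (0,1/2), b, C > 0, ε > 0. Let (u_i), (V_i) be sequences with 0 ≤ V_i ≤ b, u_i ∈ C²(B₁(0)) ∩ C¹(closure(B₁(0))) solving −Δu_i = |x−x₀|^{−2α} V_i e^{u_i} in B₁(0), u_i = 0 on ∂B₁(0), ∫_{B₁(0)} |x−x₀|^{−2α} e^{u_i} dx ≤ C, ∫_{B₁(0)} |x−x₀|^{−2α} V_i e^{u_i} dx ≤ 16π − ε. Suppose x_i ∈ B₁(0) attains the maximum of u_i on the closed disk and u_i(x_i) → +∞. Then, with δ_i = d(x_i, ∂B₁(0)) = 1 − |x_i|, one has δ_i → 0 and u_i(x_i) + 2 log δ_i − 2α log |x_i − x₀| → +∞. -/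
open MeasureTheory Metric Filter

/-- The Laplacian on `ℂ ≅ ℝ²`: sum of the two second partial derivatives. -/
noncomputable def lap (u : ℂ → ℝ) (x : ℂ) : ℝ :=
  fderiv ℝ (fun y => fderiv ℝ u y 1) x 1 +
  fderiv ℝ (fun y => fderiv ℝ u y Complex.I) x Complex.I

/-- `u` is a classical solution of problem (P) on the unit disk:
`u ∈ C²(B₁(0)) ∩ C¹(closure B₁(0))`, `-Δu = |x-x₀|^{-2α} V e^u` in `B₁(0)`, `u = 0` on `∂B₁(0)`. -/
def IsSol (α : ℝ) (x₀ : ℂ) (V u : ℂ → ℝ) : Prop :=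
  ContDiffOn ℝ 2 u (ball 0 1) ∧ ContDiffOn ℝ 1 u (closedBall 0 1) ∧
  (∀ x ∈ ball (0:ℂ) 1, -lap u x = ‖x - x₀‖ ^ (-(2*α)) * V x * Real.exp (u x)) ∧
  (∀ x ∈ sphere (0:ℂ) 1, u x = 0)

/-- Second derivatives along a fixed direction, read off from the second Fréchet derivative. -/
lemma lap_eq_fderiv_fderiv {u : ℂ → ℝ} {x : ℂ} (h : DifferentiableAt ℝ (fderiv ℝ u) x) :
    lap u x = fderiv ℝ (fderiv ℝ u) x 1 1 +
      fderiv ℝ (fderiv ℝ u) x Complex.I Complex.I := by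
  unfold lap
  rw [fderiv_clm_apply h (differentiableAt_const _), fderiv_clm_apply h (differentiableAt_const _)]
  simp

lemma differentiableAt_fderiv_of_contDiffOn {u : ℂ → ℝ} {U : Set ℂ} (hU : IsOpen U)
    (hu : ContDiffOn ℝ 2 u U) {x : ℂ} (hx : x ∈ U) : DifferentiableAt ℝ (fderiv ℝ u) x :=
  ((hu.contDiffAt (hU.mem_nhds hx)).fderiv_right (m := 1) (by norm_num)).differentiableAt
    (by norm_num)

lemma continuousOn_lap {u : ℂ → ℝ} {U : Set ℂ} (hU : IsOpen U)
    (hu : ContDiffOn ℝ 2 u U) : ContinuousOn (lap u) U := by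
  have h1 : ContDiffOn ℝ 1 (fderiv ℝ u) U := hu.fderiv_of_isOpen hU (by norm_num)
  have h2 : ContinuousOn (fderiv ℝ (fderiv ℝ u)) U := h1.continuousOn_fderiv_of_isOpen hU le_rfl
  refine ContinuousOn.congr (f := fun x => fderiv ℝ (fderiv ℝ u) x 1 1 +
      fderiv ℝ (fderiv ℝ u) x Complex.I Complex.I) (by fun_prop) ?_
  intro x hx
  exact lap_eq_fderiv_fderiv (differentiableAt_fderiv_of_contDiffOn hU hu hx)

lemma contDiffOn_comp_holomorphic {u : ℂ → ℝ} {U Ω : Set ℂ}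
    (hu : ContDiffOn ℝ 2 u U) {Φ : ℂ → ℂ} (hΩ : IsOpen Ω) (hΦ : DifferentiableOn ℂ Φ Ω)
    (hmaps : Set.MapsTo Φ Ω U) : ContDiffOn ℝ 2 (fun z => u (Φ z)) Ω :=
  hu.comp ((hΦ.contDiffOn hΩ).restrict_scalars ℝ) hmaps

lemma fderiv_comp_holomorphic_apply {u : ℂ → ℝ} {U Ω : Set ℂ} (hU : IsOpen U)
    (hu : ContDiffOn ℝ 2 u U) {Φ : ℂ → ℂ} (hΩ : IsOpen Ω) (hΦ : DifferentiableOn ℂ Φ Ω)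
    (hmaps : Set.MapsTo Φ Ω U) {z : ℂ} (hz : z ∈ Ω) (v : ℂ) :
    fderiv ℝ (fun z => u (Φ z)) z v = fderiv ℝ u (Φ z) (deriv Φ z * v) := by
  have h1 : HasFDerivAt u (fderiv ℝ u (Φ z)) (Φ z) :=
    ((hu.contDiffAt (hU.mem_nhds (hmaps hz))).differentiableAt (by norm_num)).hasFDerivAt
  have h2 := ((hΦ.differentiableAt (hΩ.mem_nhds hz)).hasDerivAt.hasFDerivAt.restrictScalars ℝ)
  have h3 : HasFDerivAt (fun z => u (Φ z)) _ z := h1.comp z h2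
  rw [h3.fderiv]
  simp [mul_comm]

/-- The Laplacian is conformally covariant in dimension two. -/
lemma lap_comp_holomorphic {u : ℂ → ℝ} {U Ω : Set ℂ} (hU : IsOpen U)
    (hu : ContDiffOn ℝ 2 u U) {Φ : ℂ → ℂ} (hΩ : IsOpen Ω) (hΦ : DifferentiableOn ℂ Φ Ω)
    (hmaps : Set.MapsTo Φ Ω U) {z : ℂ} (hz : z ∈ Ω) :
    lap (fun z => u (Φ z)) z = ‖deriv Φ z‖ ^ 2 * lap u (Φ z) := by
  have hdu := differentiableAt_fderiv_of_contDiffOn hU hu (hmaps hz)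
  have hd2 : DifferentiableAt ℂ (deriv Φ) z :=
    (hΦ.deriv hΩ).differentiableAt (hΩ.mem_nhds hz)
  have hΦz := ((hΦ.differentiableAt (hΩ.mem_nhds hz)).hasDerivAt.hasFDerivAt.restrictScalars ℝ)
  have key : ∀ v : ℂ, fderiv ℝ (fun y => fderiv ℝ (fun z => u (Φ z)) y v) z v =
      fderiv ℝ (fderiv ℝ u) (Φ z) (deriv Φ z * v) (deriv Φ z * v) +
      fderiv ℝ u (Φ z) (deriv (deriv Φ) z * v * v) := by
    intro v
    have heq : (fun y => fderiv ℝ (fun z => u (Φ z)) y v) =ᶠ[nhds z]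
        fun y => fderiv ℝ u (Φ y) (deriv Φ y * v) := by
      filter_upwards [hΩ.mem_nhds hz] with y hy
      exact fderiv_comp_holomorphic_apply hU hu hΩ hΦ hmaps hy v
    rw [heq.fderiv_eq]
    have h1 : HasFDerivAt (fun y => fderiv ℝ u (Φ y)) _ z := hdu.hasFDerivAt.comp z hΦz
    have h2 := (hd2.hasDerivAt.mul_const v).hasFDerivAt.restrictScalars ℝ
    rw [(h1.clm_apply h2).fderiv]
    simp [mul_comm, add_comm]
  unfold lap at *
  rw [key, key]
  have hI : deriv (deriv Φ) z * Complex.I * Complex.I = - (deriv (deriv Φ) z * 1 * 1) := by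
    linear_combination deriv (deriv Φ) z * Complex.I_mul_I
  rw [hI]
  have hl := lap_eq_fderiv_fderiv hdu
  unfold lap at hl
  rw [hl]
  set B := fderiv ℝ (fderiv ℝ u) (Φ z)
  set a := deriv Φ z
  have ha : a * 1 = a.re • (1:ℂ) + a.im • Complex.I := by
    apply Complex.ext <;> simp
  have haI : a * Complex.I = (-a.im) • (1:ℂ) + a.re • Complex.I := by
    apply Complex.ext <;> simp
  rw [ha, haI]
  have hn : ‖a‖ ^ 2 = a.re ^ 2 + a.im ^ 2 := by
    rw [← Complex.normSq_eq_norm_sq, Complex.normSq_apply]; ring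
  rw [hn]
  simp only [map_add, map_smul, add_apply, smul_apply,
    smul_eq_mul, map_neg]
  ring

/-- Green's identity on a rectangle for a function with period `2πi`, tested against the affine
function `z ↦ re z - t₁`. -/
lemma integral_rect_lap_of_periodic {w : ℂ → ℝ} (hw : ContDiffOn ℝ 2 w {z | z.re < 0})
    (hper : ∀ z, w (z + 2 * Real.pi * Complex.I) = w z) {t₀ t₁ : ℝ} (h01 : t₀ ≤ t₁) (h1 : t₁ < 0) :
    IntegrableOn (fun p : ℝ × ℝ => (t₁ - p.1) * -lap w (Complex.equivRealProdCLM.symm p))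
      (Set.Icc (t₀, -Real.pi) (t₁, Real.pi)) ∧
    ∫ p in Set.Icc (t₀, -Real.pi) (t₁, Real.pi),
        (t₁ - p.1) * -lap w (Complex.equivRealProdCLM.symm p) =
      ((∫ y in (-Real.pi)..Real.pi, w (Complex.equivRealProdCLM.symm (t₀, y))) +
        ∫ y in (-Real.pi)..Real.pi,
          (t₁ - t₀) * fderiv ℝ w (Complex.equivRealProdCLM.symm (t₀, y)) 1) -
      ∫ y in (-Real.pi)..Real.pi, w (Complex.equivRealProdCLM.symm (t₁, y)) := by
  set E := Complex.equivRealProdCLM.symm with hE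
  have hU : IsOpen {z : ℂ | z.re < 0} := isOpen_lt Complex.continuous_re continuous_const
  have hE1 : E (1, 0) = 1 := by apply Complex.ext <;> simp [hE]
  have hE2 : E (0, 1) = Complex.I := by apply Complex.ext <;> simp [hE]
  have hEre : ∀ p, (E p).re = p.1 := by intro p; simp [hE]
  have hmem : ∀ p ∈ Set.Icc (t₀, -Real.pi) (t₁, Real.pi), E p ∈ {z : ℂ | z.re < 0} := by
    intro p hp
    have := hp.2.1
    simp only [Set.mem_ofPred_eq, hEre]
    exact lt_of_le_of_lt this h1
  have hcd1 : ContDiffOn ℝ 1 (fderiv ℝ w) {z : ℂ | z.re < 0} :=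
    hw.fderiv_of_isOpen hU (by norm_num)
  have hc0 : ContinuousOn (fun p => w (E p)) (Set.Icc (t₀, -Real.pi) (t₁, Real.pi)) :=
    hw.continuousOn.comp E.continuous.continuousOn hmem
  have hc1 : ContinuousOn (fun p => fderiv ℝ w (E p)) (Set.Icc (t₀, -Real.pi) (t₁, Real.pi)) :=
    hcd1.continuousOn.comp E.continuous.continuousOn hmem
  have hcl : ContinuousOn (fun p => lap w (E p)) (Set.Icc (t₀, -Real.pi) (t₁, Real.pi)) :=
    (continuousOn_lap hU hw).comp E.continuous.continuousOn hmem
  have hlapInt : IntegrableOn (fun p : ℝ × ℝ => (t₁ - p.1) * -lap w (E p))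
      (Set.Icc (t₀, -Real.pi) (t₁, Real.pi)) := by
    apply ContinuousOn.integrableOn_compact isCompact_Icc
    fun_prop
  refine ⟨hlapInt, ?_⟩
  have hd0 : ∀ p ∈ Set.Icc (t₀, -Real.pi) (t₁, Real.pi),
      HasFDerivAt (fun p => w (E p)) ((fderiv ℝ w (E p)).comp (E : ℝ × ℝ →L[ℝ] ℂ)) p := by
    intro p hp
    exact (((hw.contDiffAt (hU.mem_nhds (hmem p hp))).differentiableAt
      (by norm_num)).hasFDerivAt).comp p E.hasFDerivAt
  have hd1 : ∀ p ∈ Set.Icc (t₀, -Real.pi) (t₁, Real.pi), ∀ v : ℂ,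
      HasFDerivAt (fun p => fderiv ℝ w (E p) v)
        ((((fderiv ℝ (fderiv ℝ w) (E p)).comp (E : ℝ × ℝ →L[ℝ] ℂ))).flip v) p := by
    intro p hp v
    have h := (differentiableAt_fderiv_of_contDiffOn hU hw (hmem p hp)).hasFDerivAt.comp p
      E.hasFDerivAt
    have := h.clm_apply (hasFDerivAt_const v p)
    simpa using this
  have hfst : ∀ p : ℝ × ℝ, HasFDerivAt (fun p : ℝ × ℝ => p.1 - t₁)
      (ContinuousLinearMap.fst ℝ ℝ ℝ) p := fun p => hasFDerivAt_fst.sub_const t₁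
  have hlap : ∀ p ∈ Set.Icc (t₀, -Real.pi) (t₁, Real.pi), lap w (E p) =
      fderiv ℝ (fderiv ℝ w) (E p) 1 1 + fderiv ℝ (fderiv ℝ w) (E p) Complex.I Complex.I :=
    fun p hp => lap_eq_fderiv_fderiv (differentiableAt_fderiv_of_contDiffOn hU hw (hmem p hp))
  have hsub : Set.Ioo t₀ t₁ ×ˢ Set.Ioo (-Real.pi) Real.pi ⊆
      Set.Icc (t₀, -Real.pi) (t₁, Real.pi) := by
    rintro p ⟨hp1, hp2⟩
    exact ⟨⟨hp1.1.le, hp2.1.le⟩, ⟨hp1.2.le, hp2.2.le⟩⟩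
  have hdivg := integral_divergence_prod_Icc_of_hasFDerivAt_of_le
    (fun p => (p.1 - t₁) * fderiv ℝ w (E p) 1 - w (E p))
    (fun p => (p.1 - t₁) * fderiv ℝ w (E p) Complex.I)
    (fun p => ((p.1 - t₁) • ((((fderiv ℝ (fderiv ℝ w) (E p)).comp (E : ℝ × ℝ →L[ℝ] ℂ))).flip 1) +
      (fderiv ℝ w (E p) 1) • ContinuousLinearMap.fst ℝ ℝ ℝ) -
        (fderiv ℝ w (E p)).comp (E : ℝ × ℝ →L[ℝ] ℂ))
    (fun p => (p.1 - t₁) •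
      ((((fderiv ℝ (fderiv ℝ w) (E p)).comp (E : ℝ × ℝ →L[ℝ] ℂ))).flip Complex.I) +
      (fderiv ℝ w (E p) Complex.I) • ContinuousLinearMap.fst ℝ ℝ ℝ)
    (t₀, -Real.pi) (t₁, Real.pi) ⟨h01, by simp; linarith [Real.pi_pos]⟩
    (((continuous_fst.sub continuous_const).continuousOn.mul
      (hc1.clm_apply continuousOn_const)).sub hc0)
    ((continuous_fst.sub continuous_const).continuousOn.mul (hc1.clm_apply continuousOn_const))
    (fun p hp => ((hfst p).mul (hd1 p (hsub hp) 1)).sub (hd0 p (hsub hp)))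
    (fun p hp => (hfst p).mul (hd1 p (hsub hp) Complex.I))
  have hpt : ∀ p ∈ Set.Icc (t₀, -Real.pi) (t₁, Real.pi),
      (((p.1 - t₁) • ((((fderiv ℝ (fderiv ℝ w) (E p)).comp (E : ℝ × ℝ →L[ℝ] ℂ))).flip 1) +
      (fderiv ℝ w (E p) 1) • ContinuousLinearMap.fst ℝ ℝ ℝ) -
        (fderiv ℝ w (E p)).comp (E : ℝ × ℝ →L[ℝ] ℂ)) (1, 0) +
      ((p.1 - t₁) •
      ((((fderiv ℝ (fderiv ℝ w) (E p)).comp (E : ℝ × ℝ →L[ℝ] ℂ))).flip Complex.I) +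
      (fderiv ℝ w (E p) Complex.I) • ContinuousLinearMap.fst ℝ ℝ ℝ) (0, 1) =
      (t₁ - p.1) * -lap w (E p) := by
    intro p hp
    rw [hlap p hp]
    simp [hE1, hE2]
    ring
  have hdivg := hdivg (hlapInt.congr_fun (fun p hp => (hpt p hp).symm) measurableSet_Icc)
  rw [setIntegral_congr_fun measurableSet_Icc hpt] at hdivg
  rw [hdivg]
  have hpI : ∀ x, fderiv ℝ w (E (x, Real.pi)) = fderiv ℝ w (E (x, -Real.pi)) := by
    intro x
    have : E (x, Real.pi) = E (x, -Real.pi) + 2 * Real.pi * Complex.I := by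
      apply Complex.ext <;> simp [hE]; ring
    rw [this, ← fderiv_comp_add_right]
    simp only [hper]
  simp only [hpI, sub_self, zero_mul, zero_add, zero_sub]
  have hle : -Real.pi ≤ Real.pi := by linarith [Real.pi_pos]
  have hseg : ∀ t, t₀ ≤ t → t ≤ t₁ → Set.MapsTo (fun y : ℝ => (t, y)) (Set.uIcc (-Real.pi) Real.pi)
      (Set.Icc (t₀, -Real.pi) (t₁, Real.pi)) := by
    intro t h h' y hy
    rw [Set.uIcc_of_le hle] at hy
    exact ⟨⟨h, hy.1⟩, ⟨h', hy.2⟩⟩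
  have hi1 : IntervalIntegrable (fun y => (t₀ - t₁) * fderiv ℝ w (E (t₀, y)) 1) volume
      (-Real.pi) Real.pi := by
    apply ContinuousOn.intervalIntegrable
    have := hc1.comp (f := fun y : ℝ => (t₀, y)) (by fun_prop) (hseg t₀ le_rfl h01)
    simp only [Function.comp_def] at this
    fun_prop
  have hi2 : IntervalIntegrable (fun y => w (E (t₀, y))) volume (-Real.pi) Real.pi :=
    (hc0.comp (f := fun y : ℝ => (t₀, y)) (by fun_prop) (hseg t₀ le_rfl h01)).intervalIntegrable
  rw [intervalIntegral.integral_sub hi1 hi2]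
  simp only [intervalIntegral.integral_const_mul, intervalIntegral.integral_neg]
  ring

/-- Integral representation at `-∞` for a superharmonic `2πi`-periodic function on the left
half-plane that vanishes on the imaginary axis. -/
lemma lintegral_strip_neg_lap {w : ℂ → ℝ} (hw : ContDiffOn ℝ 2 w {z | z.re < 0})
    (hper : ∀ z, w (z + 2 * Real.pi * Complex.I) = w z)
    (hneg : ∀ z : ℂ, z.re < 0 → lap w z ≤ 0) {B K L : ℝ}
    (hbd : ∀ z : ℂ, z.re < 0 → |w z| ≤ B)
    (hD : ∀ z : ℂ, z.re ≤ -1 → |fderiv ℝ w z 1| ≤ K * Real.exp z.re)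
    (hL : ∀ y : ℝ, Tendsto (fun t : ℝ => w (Complex.equivRealProdCLM.symm (t, y))) atBot (nhds L))
    (h0 : ∀ y : ℝ, Tendsto (fun t : ℝ => w (Complex.equivRealProdCLM.symm (t, y)))
      (nhdsWithin 0 (Set.Iio 0)) (nhds 0)) :
    0 ≤ L ∧ ∫⁻ p in Set.Iio (0:ℝ) ×ˢ Set.Ioc (-Real.pi) Real.pi,
      ENNReal.ofReal (-p.1 * -lap w (Complex.equivRealProdCLM.symm p)) =
        ENNReal.ofReal (2 * Real.pi * L) := by
  have hpi := Real.pi_pos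
  have hle : -Real.pi ≤ Real.pi := by linarith
  set E := Complex.equivRealProdCLM.symm with hE
  have hEre : ∀ p, (E p).re = p.1 := by intro p; simp [hE]
  have hU : IsOpen {z : ℂ | z.re < 0} := isOpen_lt Complex.continuous_re continuous_const
  set a : ℕ → ℝ := fun n => -((n:ℝ) + 1) with ha
  set c : ℕ → ℝ := fun n => -(1 / ((n:ℝ) + 1)) with hc
  have hcneg : ∀ n, c n < 0 := fun n => by simp only [hc, Left.neg_neg_iff]; positivity
  have hcge : ∀ n, -1 ≤ c n := fun n => by
    simp only [hc, neg_le_neg_iff]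
    rw [div_le_one (by positivity)]
    linarith [Nat.cast_nonneg (α := ℝ) n]
  have hale : ∀ n, a n ≤ -1 := fun n => by
    simp only [ha]; linarith [Nat.cast_nonneg (α := ℝ) n]
  have hac : ∀ n, a n ≤ c n := fun n => (hale n).trans (hcge n)
  have hcmono : Monotone c := fun m n hmn => by
    simp only [hc, neg_le_neg_iff]
    have : (m:ℝ) ≤ n := by exact_mod_cast hmn
    gcongr
  have hatend : Tendsto a atTop atBot := by
    apply tendsto_neg_atTop_atBot.comp
    exact tendsto_atTop_add_const_right _ _ tendsto_natCast_atTop_atTop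
  have hctend : Tendsto c atTop (nhds 0) := by
    simpa [hc] using (tendsto_one_div_add_atTop_nhds_zero_nat (𝕜 := ℝ)).neg
  have hctend' : Tendsto c atTop (nhdsWithin 0 (Set.Iio 0)) :=
    tendsto_nhdsWithin_iff.2 ⟨hctend, Eventually.of_forall hcneg⟩
  have hcontw : ∀ t : ℝ, t < 0 → Continuous (fun y : ℝ => w (E (t, y))) := by
    intro t ht
    exact hw.continuousOn.comp_continuous (by fun_prop) (fun y => by simpa [hE] using ht)
  have hcontD : ∀ t : ℝ, t < 0 → Continuous (fun y : ℝ => fderiv ℝ w (E (t, y))) := by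
    intro t ht
    exact (hw.fderiv_of_isOpen (m := 1) hU (by norm_num)).continuousOn.comp_continuous
      (by fun_prop) (fun y => by simpa [hE] using ht)
  have hlim1 : Tendsto (fun n => ∫ y in (-Real.pi)..Real.pi, w (E (a n, y))) atTop
      (nhds (∫ y in (-Real.pi)..Real.pi, L)) := by
    refine intervalIntegral.tendsto_integral_filter_of_dominated_convergence (fun _ => B)
      (Eventually.of_forall fun n => (hcontw _ (by linarith [hale n])).aestronglyMeasurable)
      (Eventually.of_forall fun n => ae_of_all _ fun y _ => hbd _ (by rw [hEre]; linarith [hale n]))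
      (by simp) (ae_of_all _ fun y _ => (hL y).comp hatend)
  have hlim3 : Tendsto (fun n => ∫ y in (-Real.pi)..Real.pi, w (E (c n, y))) atTop
      (nhds (∫ y in (-Real.pi)..Real.pi, 0)) := by
    refine intervalIntegral.tendsto_integral_filter_of_dominated_convergence (fun _ => B)
      (Eventually.of_forall fun n => (hcontw _ (hcneg n)).aestronglyMeasurable)
      (Eventually.of_forall fun n => ae_of_all _ fun y _ => hbd _ (by rw [hEre]; exact hcneg n))
      (by simp) (ae_of_all _ fun y _ => (h0 y).comp hctend')
  have hK : 0 ≤ K := by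
    have := (abs_nonneg _).trans (hD (-1) (by simp))
    exact nonneg_of_mul_nonneg_left this (Real.exp_pos _)
  have hexp : ∀ n, |(c n - a n) * 1| * (K * Real.exp (a n)) ≤ K * (-a n * Real.exp (a n)) := by
    intro n
    rw [mul_one, abs_of_nonneg (by linarith [hac n])]
    have : (c n - a n) ≤ -a n := by linarith [hcneg n]
    have h2 : 0 ≤ K * Real.exp (a n) := by positivity
    nlinarith
  have htexp : Tendsto (fun n => K * (-a n * Real.exp (a n))) atTop (nhds 0) := by
    have h := Real.tendsto_pow_mul_exp_neg_atTop_nhds_zero 1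
    have h2 := (h.comp (tendsto_neg_atBot_atTop.comp hatend)).const_mul K
    simpa [Function.comp_def] using h2
  have hlim2 : Tendsto (fun n => ∫ y in (-Real.pi)..Real.pi,
      (c n - a n) * fderiv ℝ w (E (a n, y)) 1) atTop (nhds 0) := by
    have hb : ∀ n, ‖∫ y in (-Real.pi)..Real.pi, (c n - a n) * fderiv ℝ w (E (a n, y)) 1‖ ≤
        K * (-a n * Real.exp (a n)) * |Real.pi - -Real.pi| := by
      intro n
      apply intervalIntegral.norm_integral_le_of_norm_le_const
      intro y _
      refine le_trans ?_ (hexp n)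
      rw [mul_one, norm_mul, Real.norm_eq_abs, Real.norm_eq_abs]
      have := hD (E (a n, y)) (by rw [hEre]; exact hale n)
      rw [hEre] at this
      gcongr
    refine squeeze_zero_norm hb ?_
    simpa using htexp.mul_const |Real.pi - -Real.pi|
  set R : ℕ → ℝ := fun n => ∫ p in Set.Icc (a n, -Real.pi) (c n, Real.pi),
        (c n - p.1) * -lap w (E p) with hR
  have hRlim : Tendsto R atTop (nhds (2 * Real.pi * L)) := by
    have := (hlim1.add hlim2).sub hlim3
    simp only [intervalIntegral.integral_const, smul_eq_mul, mul_zero, add_zero, sub_zero] at this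
    have heq : (Real.pi - -Real.pi) * L = 2 * Real.pi * L := by ring
    rw [heq] at this
    refine this.congr fun n => ?_
    exact (integral_rect_lap_of_periodic hw hper (hac n) (hcneg n)).2.symm
  have hnn : ∀ n, ∀ p ∈ Set.Icc (a n, -Real.pi) (c n, Real.pi), 0 ≤ (c n - p.1) * -lap w (E p) := by
    intro n p hp
    have h1 : p.1 ≤ c n := hp.2.1
    have := hneg (E p) (by rw [hEre]; linarith [hcneg n])
    exact mul_nonneg (by linarith) (by linarith)
  have hRnn : ∀ n, 0 ≤ R n := fun n => setIntegral_nonneg measurableSet_Icc (hnn n)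
  have hpos : 0 ≤ 2 * Real.pi * L := ge_of_tendsto' hRlim hRnn
  refine ⟨nonneg_of_mul_nonneg_right hpos (by positivity), ?_⟩
  have hset : Set.Iio (0:ℝ) ×ˢ Set.Ioc (-Real.pi) Real.pi =ᵐ[volume]
      Set.Iio (0:ℝ) ×ˢ Set.Icc (-Real.pi) Real.pi := by
    exact Measure.set_prod_ae_eq (ae_eq_refl _) Ioc_ae_eq_Icc
  rw [setLIntegral_congr hset]
  set S := Set.Iio (0:ℝ) ×ˢ Set.Icc (-Real.pi) Real.pi with hS
  have hSm : MeasurableSet S := measurableSet_Iio.prod measurableSet_Icc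
  set F : ℕ → ℝ × ℝ → ENNReal := fun n => (Set.Icc (a n, -Real.pi) (c n, Real.pi)).indicator
    fun p => ENNReal.ofReal ((c n - p.1) * -lap w (E p)) with hF
  have hsub : ∀ n, Set.Icc (a n, -Real.pi) (c n, Real.pi) ⊆ S := by
    intro n p hp
    exact ⟨lt_of_le_of_lt hp.2.1 (hcneg n), hp.1.2, hp.2.2⟩
  have hFint : ∀ n, ∫⁻ p in S, F n p = ENNReal.ofReal (R n) := by
    intro n
    rw [hF, lintegral_indicator measurableSet_Icc, Measure.restrict_restrict measurableSet_Icc,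
      Set.inter_eq_left.2 (hsub n)]
    rw [hR, ofReal_integral_eq_lintegral_ofReal]
    · exact (integral_rect_lap_of_periodic hw hper (hac n) (hcneg n)).1
    · exact (ae_restrict_iff' measurableSet_Icc).2 (ae_of_all _ (hnn n))
  have hFm : ∀ n, AEMeasurable (F n) (volume.restrict S) := by
    intro n
    rw [hF, aemeasurable_indicator_iff measurableSet_Icc,
      Measure.restrict_restrict measurableSet_Icc, Set.inter_eq_left.2 (hsub n)]
    exact (integral_rect_lap_of_periodic hw hper (hac n) (hcneg n)).1.aemeasurable.ennreal_ofReal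
  have hmono : ∀ p ∈ S, Monotone fun n => F n p := by
    intro p hp m n hmn
    simp only [hF]
    by_cases h : p ∈ Set.Icc (a m, -Real.pi) (c m, Real.pi)
    · have han : a n ≤ a m := by
        simp only [ha, neg_le_neg_iff]
        have : (m:ℝ) ≤ n := by exact_mod_cast hmn
        linarith
      have h' : p ∈ Set.Icc (a n, -Real.pi) (c n, Real.pi) :=
        ⟨⟨han.trans h.1.1, h.1.2⟩, ⟨h.2.1.trans (hcmono hmn), h.2.2⟩⟩
      rw [Set.indicator_of_mem h, Set.indicator_of_mem h']
      apply ENNReal.ofReal_le_ofReal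
      have := hneg (E p) (by rw [hEre]; exact hp.1)
      exact mul_le_mul_of_nonneg_right (by linarith [hcmono hmn]) (by linarith)
    · rw [Set.indicator_of_notMem h]
      exact zero_le
  have htend : ∀ p ∈ S, Tendsto (fun n => F n p) atTop
      (nhds (ENNReal.ofReal (-p.1 * -lap w (E p)))) := by
    intro p hp
    have h1 : ∀ᶠ n in atTop, a n ≤ p.1 := hatend.eventually_le_atBot _
    have h2 : ∀ᶠ n in atTop, p.1 < c n := hctend.eventually_const_lt hp.1
    have h3 : Tendsto (fun n => ENNReal.ofReal ((c n - p.1) * -lap w (E p))) atTop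
        (nhds (ENNReal.ofReal ((0 - p.1) * -lap w (E p)))) :=
      ENNReal.tendsto_ofReal ((hctend.sub_const _).mul_const _)
    rw [zero_sub] at h3
    refine h3.congr' ?_
    filter_upwards [h1, h2] with n hn1 hn2
    simp only [hF]
    rw [Set.indicator_of_mem]
    exact ⟨⟨hn1, hp.2.1⟩, ⟨hn2.le, hp.2.2⟩⟩
  have hlim := lintegral_tendsto_of_tendsto_of_monotone hFm
    ((ae_restrict_iff' hSm).2 (ae_of_all _ hmono)) ((ae_restrict_iff' hSm).2 (ae_of_all _ htend))
  simp only [hFint] at hlim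
  exact tendsto_nhds_unique hlim (ENNReal.tendsto_ofReal hRlim)

/-- Change of variables along an injective holomorphic map. -/
lemma lintegral_image_holomorphic {Φ : ℂ → ℂ} {S Ω : Set ℂ} (hΩ : IsOpen Ω)
    (hΦ : DifferentiableOn ℂ Φ Ω) (hS : MeasurableSet S) (hSΩ : S ⊆ Ω) (hinj : Set.InjOn Φ S)
    (g : ℂ → ENNReal) :
    ∫⁻ y in Φ '' S, g y = ∫⁻ z in S, ENNReal.ofReal (‖deriv Φ z‖ ^ 2) * g (Φ z) := by
  have hd : ∀ z ∈ S, HasFDerivWithinAt Φ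
      ((ContinuousLinearMap.toSpanSingleton ℂ (deriv Φ z)).restrictScalars ℝ) S z := fun z hz =>
    ((hΦ.differentiableAt (hΩ.mem_nhds (hSΩ hz))).hasDerivAt.hasFDerivAt.restrictScalars
      ℝ).hasFDerivWithinAt
  rw [lintegral_image_eq_lintegral_abs_det_fderiv_mul volume hS hd hinj]
  refine setLIntegral_congr_fun hS fun z _ => ?_
  have hdet : |((ContinuousLinearMap.toSpanSingleton ℂ (deriv Φ z)).restrictScalars ℝ).det| =
      ‖deriv Φ z‖ ^ 2 := by
    simp [ContinuousLinearMap.det, LinearMap.det_restrictScalars, Algebra.norm_complex_apply,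
      Complex.normSq_eq_norm_sq]
  simp only [hdet]

/-- Green representation at the centre of the unit disk for a superharmonic function vanishing on
the boundary. -/
lemma green_representation_zero {v : ℂ → ℝ} (hv : ContDiffOn ℝ 2 v (ball 0 1))
    (hvc : ContinuousOn v (closedBall 0 1)) (hv0 : ∀ x ∈ sphere (0:ℂ) 1, v x = 0)
    (hlap : ∀ x ∈ ball (0:ℂ) 1, lap v x ≤ 0) :
    0 ≤ v 0 ∧ ∫⁻ z in ball (0:ℂ) 1, ENNReal.ofReal (-Real.log ‖z‖ * -lap v z) =
      ENNReal.ofReal (2 * Real.pi * v 0) := by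
  set E := Complex.equivRealProdCLM.symm with hE
  have hU : IsOpen {z : ℂ | z.re < 0} := isOpen_lt Complex.continuous_re continuous_const
  have hnorm : ∀ z : ℂ, ‖Complex.exp z‖ = Real.exp z.re := Complex.norm_exp
  have hmaps : Set.MapsTo Complex.exp {z : ℂ | z.re < 0} (ball 0 1) := by
    intro z hz
    rw [mem_ball_zero_iff, hnorm]
    exact Real.exp_lt_one_iff.2 hz
  have hdexp : DifferentiableOn ℂ Complex.exp {z : ℂ | z.re < 0} :=
    Complex.differentiable_exp.differentiableOn
  have hlapw : ∀ z : ℂ, z.re < 0 → lap (fun z => v (Complex.exp z)) z =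
      ‖deriv Complex.exp z‖ ^ 2 * lap v (Complex.exp z) := fun z hz =>
    lap_comp_holomorphic isOpen_ball hv hU hdexp hmaps hz
  obtain ⟨B, hB⟩ := (isCompact_closedBall (0:ℂ) 1).exists_bound_of_continuousOn hvc
  have hcl : closedBall (0:ℂ) (Real.exp (-1)) ⊆ ball 0 1 :=
    closedBall_subset_ball (by rw [Real.exp_lt_one_iff]; norm_num)
  obtain ⟨K, hK⟩ := (isCompact_closedBall (0:ℂ) (Real.exp (-1))).exists_bound_of_continuousOn
    ((hv.fderiv_of_isOpen (m := 1) isOpen_ball (by norm_num)).continuousOn.mono hcl)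
  have key := lintegral_strip_neg_lap (w := fun z => v (Complex.exp z)) (B := B) (K := K) (L := v 0)
    (contDiffOn_comp_holomorphic hv hU hdexp hmaps)
    (fun z => by simp only [Complex.exp_add, Complex.exp_two_pi_mul_I, mul_one])
    (fun z hz => by
      rw [hlapw z hz]
      exact mul_nonpos_of_nonneg_of_nonpos (by positivity) (hlap _ (hmaps hz)))
    (fun z hz => hB _ (ball_subset_closedBall (hmaps hz)))
    (fun z hz => by
      have hz0 : z ∈ {z : ℂ | z.re < 0} := by
        change z.re < 0
        linarith
      rw [fderiv_comp_holomorphic_apply isOpen_ball hv hU hdexp hmaps hz0, Complex.deriv_exp,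
        mul_one, ← hnorm, ← Real.norm_eq_abs]
      refine (ContinuousLinearMap.le_opNorm _ _).trans ?_
      gcongr
      apply hK
      rw [mem_closedBall_zero_iff, hnorm]
      exact Real.exp_le_exp.2 hz)
    (fun y => by
      have h1 : Tendsto (fun t : ℝ => Complex.exp (E (t, y))) atBot (nhds 0) := by
        apply Complex.tendsto_exp_comap_re_atBot.comp
        rw [tendsto_comap_iff]
        exact tendsto_id.congr fun t => by simp [hE]
      exact ((hv.continuousOn.continuousAt
        (isOpen_ball.mem_nhds (mem_ball_self one_pos))).tendsto).comp h1)
    (fun y => by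
      have hs : Complex.exp (E (0, y)) ∈ sphere (0:ℂ) 1 := by
        rw [mem_sphere_zero_iff_norm, hnorm]
        simp [hE]
      have h1 : Tendsto (fun t : ℝ => Complex.exp (E (t, y))) (nhdsWithin 0 (Set.Iio 0))
          (nhdsWithin (Complex.exp (E (0, y))) (closedBall 0 1)) := by
        refine tendsto_nhdsWithin_iff.2 ⟨?_, ?_⟩
        · have : Continuous (fun t : ℝ => Complex.exp (E (t, y))) := by fun_prop
          exact (this.tendsto 0).mono_left nhdsWithin_le_nhds
        · filter_upwards [self_mem_nhdsWithin] with t ht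
          refine ball_subset_closedBall (hmaps ?_)
          change (E (t, y)).re < 0
          simpa [hE] using ht
      have h2 := (hvc _ (sphere_subset_closedBall hs)).tendsto.comp h1
      rwa [hv0 _ hs] at h2)
  refine ⟨key.1, ?_⟩
  rw [← key.2]
  set S : Set ℂ := {z : ℂ | z.re < 0 ∧ z.im ∈ Set.Ioc (-Real.pi) Real.pi} with hS
  have hSm : MeasurableSet S :=
    (Complex.measurable_re measurableSet_Iio).inter (Complex.measurable_im measurableSet_Ioc)
  have himg : Complex.exp '' S = ball 0 1 \ {0} := by
    ext y
    constructor
    · rintro ⟨z, hz, rfl⟩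
      exact ⟨hmaps hz.1, Complex.exp_ne_zero z⟩
    · rintro ⟨hy, hy0⟩
      refine ⟨Complex.log y, ⟨?_, ?_⟩, Complex.exp_log hy0⟩
      · rw [Complex.log_re]
        exact Real.log_neg (norm_pos_iff.2 hy0) (mem_ball_zero_iff.1 hy)
      · exact ⟨Complex.neg_pi_lt_log_im y, Complex.log_im_le_pi y⟩
  have hinj : Set.InjOn Complex.exp S := by
    intro z hz z' hz' h
    exact Complex.exp_inj_of_neg_pi_lt_of_le_pi hz.2.1 hz.2.2 hz'.2.1 hz'.2.2 h
  have hae : (ball (0:ℂ) 1 : Set ℂ) =ᵐ[volume] (ball 0 1 \ {0} : Set ℂ) :=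
    (sdiff_null_ae_eq_self (measure_singleton 0)).symm
  rw [setLIntegral_congr hae, ← himg, lintegral_image_holomorphic hU hdexp hSm
    (fun z hz => hz.1) hinj]
  have hpre : Set.Iio (0:ℝ) ×ˢ Set.Ioc (-Real.pi) Real.pi =
      Complex.measurableEquivRealProd.symm ⁻¹' S := rfl
  have htr := Complex.volume_preserving_equiv_real_prod.symm.setLIntegral_comp_preimage_emb
    Complex.measurableEquivRealProd.symm.measurableEmbedding
    (fun z => ENNReal.ofReal (-z.re * -lap (fun z => v (Complex.exp z)) z)) S
  rw [hpre]
  refine Eq.trans ?_ htr.symm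
  refine setLIntegral_congr_fun hSm fun z hz => ?_
  simp only [hlapw z hz.1, hnorm, Real.log_exp]
  rw [← ENNReal.ofReal_mul (by positivity)]
  congr 1
  ring

/-- The automorphism of the unit disk sending `0` to `p`. -/
noncomputable def diskShift (p z : ℂ) : ℂ := (z + p) / (1 + starRingEnd ℂ p * z)

lemma one_add_conj_mul_ne_zero {p z : ℂ} (hp : ‖p‖ < 1) (hz : ‖z‖ ≤ 1) :
    1 + starRingEnd ℂ p * z ≠ 0 := by
  intro h
  have h1 : starRingEnd ℂ p * z = -1 := by linear_combination h
  have h2 : ‖p‖ * ‖z‖ = 1 := by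
    simpa using congrArg norm h1
  nlinarith [norm_nonneg p, norm_nonneg z]

lemma normSq_one_add_conj_mul_sub (p z : ℂ) :
    ‖1 + starRingEnd ℂ p * z‖ ^ 2 - ‖z + p‖ ^ 2 = (1 - ‖p‖ ^ 2) * (1 - ‖z‖ ^ 2) := by
  simp only [← Complex.normSq_eq_norm_sq, Complex.normSq_apply]
  simp
  ring

lemma norm_diskShift_lt_one {p z : ℂ} (hp : ‖p‖ < 1) (hz : ‖z‖ < 1) : ‖diskShift p z‖ < 1 := by
  rw [diskShift, norm_div, div_lt_one (norm_pos_iff.2 (one_add_conj_mul_ne_zero hp hz.le))]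
  have h := normSq_one_add_conj_mul_sub p z
  have : 0 < (1 - ‖p‖ ^ 2) * (1 - ‖z‖ ^ 2) :=
    mul_pos (by nlinarith [norm_nonneg p]) (by nlinarith [norm_nonneg z])
  exact lt_of_pow_lt_pow_left₀ 2 (norm_nonneg _) (by linarith)

lemma norm_diskShift_eq_one {p z : ℂ} (hp : ‖p‖ < 1) (hz : ‖z‖ = 1) : ‖diskShift p z‖ = 1 := by
  rw [diskShift, norm_div, div_eq_one_iff_eq
    (norm_pos_iff.2 (one_add_conj_mul_ne_zero hp hz.le)).ne']
  have h := normSq_one_add_conj_mul_sub p z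
  rw [hz] at h
  exact (pow_left_inj₀ (norm_nonneg _) (norm_nonneg _) two_ne_zero).1 (by linarith)

lemma diskShift_neg_diskShift {p z : ℂ} (hp : ‖p‖ < 1) (hz : ‖z‖ < 1) :
    diskShift (-p) (diskShift p z) = z := by
  have h1 := one_add_conj_mul_ne_zero hp hz.le
  have h2 := one_add_conj_mul_ne_zero (p := -p) (by simpa using hp) (norm_diskShift_lt_one hp hz).le
  have h3 : diskShift p z * (1 + starRingEnd ℂ p * z) = z + p := div_mul_cancel₀ _ h1
  have h4 : diskShift (-p) (diskShift p z) =
    (diskShift p z + -p) / (1 + starRingEnd ℂ (-p) * diskShift p z) := rfl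
  rw [h4, div_eq_iff h2]
  simp only [map_neg]
  linear_combination h3

lemma differentiableOn_diskShift {p : ℂ} (hp : ‖p‖ < 1) :
    DifferentiableOn ℂ (diskShift p) (ball 0 1) := by
  intro z hz
  apply DifferentiableAt.differentiableWithinAt
  unfold diskShift
  exact DifferentiableAt.div (by fun_prop) (by fun_prop)
    (one_add_conj_mul_ne_zero hp (mem_ball_zero_iff.1 hz).le)

lemma continuousOn_diskShift {p : ℂ} (hp : ‖p‖ < 1) :
    ContinuousOn (diskShift p) (closedBall 0 1) := by
  unfold diskShift
  exact ContinuousOn.div (by fun_prop) (by fun_prop)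
    fun z hz => one_add_conj_mul_ne_zero hp (mem_closedBall_zero_iff.1 hz)

/-- The Green function of the unit disk, up to the factor `2π`. -/
noncomputable def greenKernel (p y : ℂ) : ℝ :=
  Real.log (‖1 - starRingEnd ℂ p * y‖ / ‖y - p‖)

lemma greenKernel_eq (p y : ℂ) : greenKernel p y = -Real.log ‖diskShift (-p) y‖ := by
  rw [greenKernel, diskShift, norm_div, ← Real.log_inv, inv_div]
  simp only [map_neg, neg_mul, ← sub_eq_add_neg]

lemma greenKernel_nonneg {p y : ℂ} (hp : ‖p‖ < 1) (hy : ‖y‖ < 1) : 0 ≤ greenKernel p y := by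
  rw [greenKernel_eq, Left.nonneg_neg_iff]
  exact Real.log_nonpos (norm_nonneg _) (norm_diskShift_lt_one (by simpa using hp) hy).le

/-- Green representation in the unit disk for a superharmonic function vanishing on the
boundary. -/
lemma green_representation {u : ℂ → ℝ} (hu : ContDiffOn ℝ 2 u (ball 0 1))
    (huc : ContinuousOn u (closedBall 0 1)) (hu0 : ∀ x ∈ sphere (0:ℂ) 1, u x = 0)
    (hlap : ∀ x ∈ ball (0:ℂ) 1, lap u x ≤ 0) {p : ℂ} (hp : ‖p‖ < 1) :
    0 ≤ u p ∧ ∫⁻ y in ball (0:ℂ) 1, ENNReal.ofReal (greenKernel p y * -lap u y) =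
      ENNReal.ofReal (2 * Real.pi * u p) := by
  have hmaps : Set.MapsTo (diskShift p) (ball 0 1) (ball 0 1) := fun z hz =>
    mem_ball_zero_iff.2 (norm_diskShift_lt_one hp (mem_ball_zero_iff.1 hz))
  have hsph : ∀ z ∈ sphere (0:ℂ) 1, diskShift p z ∈ sphere (0:ℂ) 1 := fun z hz =>
    mem_sphere_zero_iff_norm.2 (norm_diskShift_eq_one hp (mem_sphere_zero_iff_norm.1 hz))
  have hmapsc : Set.MapsTo (diskShift p) (closedBall 0 1) (closedBall 0 1) := by
    intro z hz
    rcases (mem_closedBall_zero_iff.1 hz).lt_or_eq with h | h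
    · exact ball_subset_closedBall (hmaps (mem_ball_zero_iff.2 h))
    · exact sphere_subset_closedBall (hsph z (mem_sphere_zero_iff_norm.2 h))
  have hlapv : ∀ z ∈ ball (0:ℂ) 1, lap (fun z => u (diskShift p z)) z =
      ‖deriv (diskShift p) z‖ ^ 2 * lap u (diskShift p z) := fun z hz =>
    lap_comp_holomorphic isOpen_ball hu isOpen_ball (differentiableOn_diskShift hp) hmaps hz
  have h0 : diskShift p 0 = p := by simp [diskShift]
  have key := green_representation_zero (v := fun z => u (diskShift p z))
    (contDiffOn_comp_holomorphic hu isOpen_ball (differentiableOn_diskShift hp) hmaps)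
    (huc.comp (continuousOn_diskShift hp) hmapsc) (fun z hz => hu0 _ (hsph z hz))
    (fun z hz => by
      rw [hlapv z hz]
      exact mul_nonpos_of_nonneg_of_nonpos (by positivity) (hlap _ (hmaps hz)))
  simp only [h0] at key
  refine ⟨key.1, ?_⟩
  rw [← key.2]
  have hinj : Set.InjOn (diskShift p) (ball 0 1) := by
    intro z hz z' hz' h
    rw [← diskShift_neg_diskShift hp (mem_ball_zero_iff.1 hz), h,
      diskShift_neg_diskShift hp (mem_ball_zero_iff.1 hz')]
  have himg : diskShift p '' ball 0 1 = ball 0 1 := by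
    refine Set.Subset.antisymm hmaps.image_subset fun y hy => ?_
    have hp' : ‖-p‖ < 1 := by simpa using hp
    refine ⟨diskShift (-p) y,
      mem_ball_zero_iff.2 (norm_diskShift_lt_one hp' (mem_ball_zero_iff.1 hy)), ?_⟩
    simpa using diskShift_neg_diskShift hp' (mem_ball_zero_iff.1 hy)
  conv_lhs => rw [← himg]
  rw [lintegral_image_holomorphic isOpen_ball (differentiableOn_diskShift hp) measurableSet_ball
    subset_rfl hinj]
  refine setLIntegral_congr_fun measurableSet_ball fun z hz => ?_
  simp only [hlapv z hz, greenKernel_eq, diskShift_neg_diskShift hp (mem_ball_zero_iff.1 hz)]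
  rw [← ENNReal.ofReal_mul (by positivity)]
  congr 1
  ring

lemma integrable_radial_iff {h : ℝ → ℝ} (p : ℂ) :
    Integrable (fun y : ℂ => h ‖y - p‖) ↔ IntegrableOn (fun s => s * h s) (Set.Ioi 0) := by
  have h1 := integrable_fun_norm_addHaar (volume : Measure ℂ) (f := h)
  simp only [Complex.finrank_real_complex, Nat.add_one_sub_one, pow_one, smul_eq_mul] at h1
  rw [← h1]
  exact ⟨fun hi => by simpa using hi.comp_add_right p, fun hi => hi.comp_sub_right p⟩

lemma integral_radial (h : ℝ → ℝ) (p : ℂ) :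
    ∫ y : ℂ, h ‖y - p‖ = 2 * Real.pi * ∫ s in Set.Ioi (0:ℝ), s * h s := by
  rw [integral_sub_right_eq_self (fun y : ℂ => h ‖y‖) p,
    integral_fun_norm_addHaar (volume : Measure ℂ) h]
  simp [Complex.finrank_real_complex, Measure.real, Complex.volume_ball]
  ring

/-- The weight `ρ / |y - p|` cut off at distance `ρ`. -/
lemma integral_inv_dist_ball (p : ℂ) {ρ : ℝ} (hρ : 0 < ρ) :
    Integrable (fun y : ℂ => (ball p ρ).indicator (fun y => ρ / ‖y - p‖) y) ∧
    ∫ y : ℂ, (ball p ρ).indicator (fun y => ρ / ‖y - p‖) y = 2 * Real.pi * ρ ^ 2 := by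
  have heq : (fun y : ℂ => (ball p ρ).indicator (fun y => ρ / ‖y - p‖) y) =
      fun y => (Set.Iio ρ).indicator (fun s => ρ / s) ‖y - p‖ := by
    ext y
    simp only [Set.indicator, mem_ball_iff_norm, Set.mem_Iio]
  have heq2 : Set.EqOn (fun s : ℝ => s * (Set.Iio ρ).indicator (fun s => ρ / s) s)
      ((Set.Iio ρ).indicator (fun _ => ρ)) (Set.Ioi 0) := by
    intro s hs
    have hs' : s ≠ 0 := ne_of_gt hs
    by_cases h : s < ρ
    · simp [Set.indicator, h]; field_simp
    · simp [Set.indicator, h]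
  have hinter : Set.Ioi 0 ∩ Set.Iio ρ = Set.Ioo 0 ρ := Set.Ioi_inter_Iio
  rw [heq]
  constructor
  · rw [integrable_radial_iff, integrableOn_congr_fun heq2 measurableSet_Ioi, IntegrableOn,
      integrable_indicator_iff measurableSet_Iio, IntegrableOn,
      Measure.restrict_restrict measurableSet_Iio, Set.inter_comm, hinter]
    exact integrableOn_const (by simp)
  · rw [integral_radial, setIntegral_congr_fun measurableSet_Ioi heq2,
      setIntegral_indicator measurableSet_Iio, hinter]
    simp [hρ.le]
    ring

/-- The weight `(a / |y - p|)²` on an annulus. -/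
lemma integral_inv_dist_sq_annulus (p : ℂ) {r a : ℝ} (hr : 0 < r) (hra : r ≤ a) :
    Integrable (fun y : ℂ => (Set.Ico r a).indicator (fun s => (a / s) ^ 2) ‖y - p‖) ∧
    ∫ y : ℂ, (Set.Ico r a).indicator (fun s => (a / s) ^ 2) ‖y - p‖ =
      2 * Real.pi * (a ^ 2 * Real.log (a / r)) := by
  have ha : 0 < a := hr.trans_le hra
  have heq2 : Set.EqOn (fun s : ℝ => s * (Set.Ico r a).indicator (fun s => (a / s) ^ 2) s)
      ((Set.Ico r a).indicator (fun s => a ^ 2 * s⁻¹)) (Set.Ioi 0) := by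
    intro s hs
    have hs' : s ≠ 0 := ne_of_gt hs
    by_cases h : s ∈ Set.Ico r a
    · simp only [Set.indicator_of_mem h]; field_simp
    · simp only [Set.indicator_of_notMem h, mul_zero]
  have hinter : Set.Ioi 0 ∩ Set.Ico r a = Set.Ico r a :=
    Set.inter_eq_right.2 fun s hs => hr.trans_le hs.1
  have h0 : (0:ℝ) ∉ Set.uIcc r a := by
    rw [Set.uIcc_of_le hra]
    exact fun h => absurd h.1 (not_le.2 hr)
  constructor
  · rw [integrable_radial_iff, integrableOn_congr_fun heq2 measurableSet_Ioi, IntegrableOn,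
      integrable_indicator_iff measurableSet_Ico, IntegrableOn,
      Measure.restrict_restrict measurableSet_Ico, Set.inter_comm, hinter]
    have hc : IntervalIntegrable (fun s => a ^ 2 * s⁻¹) volume r a :=
      (intervalIntegrable_inv_iff.2 (Or.inr h0)).const_mul _
    exact ((intervalIntegrable_iff_integrableOn_Ico_of_le hra).1 hc)
  · rw [integral_radial, setIntegral_congr_fun measurableSet_Ioi heq2,
      setIntegral_indicator measurableSet_Ico, hinter, integral_Ico_eq_integral_Ioc,
      ← intervalIntegral.integral_of_le hra, intervalIntegral.integral_const_mul,
      integral_inv h0]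

lemma integrableOn_norm_sub_rpow (x₀ : ℂ) {β : ℝ} (hβ : β < 2) :
    IntegrableOn (fun y : ℂ => ‖y - x₀‖ ^ (-β)) (ball 0 1) := by
  have h : IntegrableOn (fun y : ℂ => ‖y‖ ^ (-β)) (ball 0 (1 + ‖x₀‖)) :=
    integrableOn_ball_of_norm_le_rpow (C := 1) (α := β) (by simp [Complex.finrank_real_complex])
      (by simpa [Complex.finrank_real_complex] using hβ)
      (ae_of_all _ fun y => by rw [one_mul, Real.norm_of_nonneg (by positivity)])
      (measurable_norm.pow_const _).aestronglyMeasurable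
  have h2 := (((integrable_indicator_iff measurableSet_ball).2 h).comp_sub_right x₀).integrableOn
    (s := ball (0:ℂ) 1)
  refine h2.congr_fun (fun y hy => ?_) measurableSet_ball
  refine Set.indicator_of_mem ?_ _
  rw [mem_ball_zero_iff] at hy ⊢
  exact (norm_sub_le _ _).trans_lt (by linarith)

lemma greenKernel_le {p y : ℂ} (hp : ‖p‖ < 1) {ρ : ℝ} (hρ : 0 < ρ) :
    greenKernel p y ≤ Real.log (1 + 2 * (1 - ‖p‖) / ρ) +
      (ball p ρ).indicator (fun y => ρ / ‖y - p‖) y := by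
  have hd : 0 ≤ 2 * (1 - ‖p‖) := by linarith
  have hlog : 0 ≤ Real.log (1 + 2 * (1 - ‖p‖) / ρ) :=
    Real.log_nonneg (by linarith [div_nonneg hd hρ.le])
  have hind : 0 ≤ (ball p ρ).indicator (fun y => ρ / ‖y - p‖) y :=
    Set.indicator_nonneg (fun y _ => by positivity) y
  rcases eq_or_ne y p with rfl | hne
  · have : greenKernel y y = 0 := by simp [greenKernel]
    linarith
  have hs : 0 < ‖y - p‖ := norm_pos_iff.2 (sub_ne_zero.2 hne)
  have hnum : ‖1 - starRingEnd ℂ p * y‖ ≤ 2 * (1 - ‖p‖) + ‖y - p‖ := by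
    have h1 : 1 - starRingEnd ℂ p * y =
        ((1 - ‖p‖ ^ 2 : ℝ) : ℂ) - starRingEnd ℂ p * (y - p) := by
      have := Complex.conj_mul' p
      push_cast
      linear_combination -this
    rw [h1]
    refine (norm_sub_le _ _).trans ?_
    rw [Complex.norm_real, norm_mul, Complex.norm_conj, Real.norm_of_nonneg
      (by nlinarith [norm_nonneg p])]
    nlinarith [norm_nonneg p]
  by_cases hnum0 : ‖1 - starRingEnd ℂ p * y‖ = 0
  · have : greenKernel p y = 0 := by simp [greenKernel, hnum0]
    linarith
  have hnum_pos : 0 < ‖1 - starRingEnd ℂ p * y‖ := lt_of_le_of_ne (norm_nonneg _) (Ne.symm hnum0)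
  have hle : greenKernel p y ≤ Real.log ((2 * (1 - ‖p‖) + ‖y - p‖) / ‖y - p‖) :=
    Real.log_le_log (by positivity) (by gcongr)
  by_cases hy : ‖y - p‖ < ρ
  · rw [Set.indicator_of_mem (mem_ball_iff_norm.2 hy)]
    have h2 : (2 * (1 - ‖p‖) + ‖y - p‖) / ‖y - p‖ ≤
        (1 + 2 * (1 - ‖p‖) / ρ) * (ρ / ‖y - p‖) := by
      have : (1 + 2 * (1 - ‖p‖) / ρ) * (ρ / ‖y - p‖) = (2 * (1 - ‖p‖) + ρ) / ‖y - p‖ := by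
        field_simp
        ring
      rw [this]
      gcongr
    have h3 := Real.log_le_log (by positivity) h2
    rw [Real.log_mul (by positivity) (by positivity)] at h3
    have h4 : Real.log (ρ / ‖y - p‖) ≤ ρ / ‖y - p‖ := Real.log_le_self (by positivity)
    linarith
  · have h2 : (2 * (1 - ‖p‖) + ‖y - p‖) / ‖y - p‖ ≤ 1 + 2 * (1 - ‖p‖) / ρ := by
      rw [add_div, div_self hs.ne', add_comm]
      push Not at hy
      gcongr
    have h3 := Real.log_le_log (by positivity) h2
    linarith

/-- Pointwise upper bound for the solution in terms of the mass near and far from the point. -/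
lemma two_pi_mul_le_of_neg_lap_le {u : ℂ → ℝ} (hu : ContDiffOn ℝ 2 u (ball 0 1))
    (huc : ContinuousOn u (closedBall 0 1)) (hu0 : ∀ x ∈ sphere (0:ℂ) 1, u x = 0)
    (hlap : ∀ x ∈ ball (0:ℂ) 1, lap u x ≤ 0)
    (hlapInt : IntegrableOn (fun y => -lap u y) (ball 0 1)) {p : ℂ} (hp : ‖p‖ < 1)
    {ρ r K : ℝ} (hρ : 0 < ρ) (hρr : ρ ≤ r) (hK0 : 0 ≤ K)
    (hrs : ball p r ⊆ ball 0 1) (hK : ∀ y ∈ ball p ρ, -lap u y ≤ K) :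
    2 * Real.pi * u p ≤ Real.log (1 + 2 * (1 - ‖p‖) / ρ) * (∫ y in ball p r, -lap u y) +
      Real.log (1 + 2 * (1 - ‖p‖) / r) * (∫ y in ball (0:ℂ) 1, -lap u y) +
      K * (2 * Real.pi * ρ ^ 2) := by
  have hr : 0 < r := hρ.trans_le hρr
  have hd : 0 ≤ 2 * (1 - ‖p‖) := by linarith
  set c₁ := Real.log (1 + 2 * (1 - ‖p‖) / ρ) with hc₁
  set c₂ := Real.log (1 + 2 * (1 - ‖p‖) / r) with hc₂
  have hc₁0 : 0 ≤ c₁ := Real.log_nonneg (by linarith [div_nonneg hd hρ.le])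
  have hc₂0 : 0 ≤ c₂ := Real.log_nonneg (by linarith [div_nonneg hd hr.le])
  obtain ⟨hHi, hH⟩ := integral_inv_dist_ball p hρ
  set H : ℂ → ℝ := fun y => (ball p ρ).indicator (fun y => ρ / ‖y - p‖) y with hHdef
  have hHnn : ∀ y, 0 ≤ H y := fun y => Set.indicator_nonneg (fun y _ => by positivity) y
  set g : ℂ → ℝ := fun y => (c₁ * (ball p r).indicator (fun y => -lap u y) y + c₂ * -lap u y) +
    K * H y with hg
  have hi1 : IntegrableOn (fun y => c₁ * (ball p r).indicator (fun y => -lap u y) y) (ball 0 1) :=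
    ((IntegrableOn.integrable_indicator (hlapInt.mono_set hrs) measurableSet_ball).integrableOn
      ).const_mul c₁
  have hi2 : IntegrableOn (fun y => c₂ * -lap u y) (ball 0 1) := hlapInt.const_mul c₂
  have hi3 : IntegrableOn (fun y => K * H y) (ball 0 1) := hHi.integrableOn.const_mul K
  have hle : ∀ y ∈ ball (0:ℂ) 1, greenKernel p y * -lap u y ≤ g y := by
    intro y hy
    have hf0 : 0 ≤ -lap u y := by linarith [hlap y hy]
    by_cases hyr : y ∈ ball p r
    · simp only [hg, Set.indicator_of_mem hyr]
      have h1 : greenKernel p y * -lap u y ≤ (c₁ + H y) * -lap u y :=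
        mul_le_mul_of_nonneg_right (greenKernel_le hp hρ) hf0
      have h2 : H y * -lap u y ≤ K * H y := by
        by_cases hyρ : y ∈ ball p ρ
        · rw [mul_comm]
          exact mul_le_mul_of_nonneg_right (hK y hyρ) (hHnn y)
        · simp [hHdef, Set.indicator_of_notMem hyρ]
      nlinarith [mul_nonneg hc₂0 hf0]
    · simp only [hg, Set.indicator_of_notMem hyr]
      have h1 := greenKernel_le hp hr (y := y)
      rw [Set.indicator_of_notMem hyr, add_zero] at h1
      have h2 : greenKernel p y * -lap u y ≤ c₂ * -lap u y := mul_le_mul_of_nonneg_right h1 hf0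
      nlinarith [mul_nonneg hK0 (hHnn y)]
  have hg0 : ∀ y ∈ ball (0:ℂ) 1, 0 ≤ g y := by
    intro y hy
    refine le_trans (mul_nonneg (greenKernel_nonneg hp (mem_ball_zero_iff.1 hy)) ?_) (hle y hy)
    linarith [hlap y hy]
  have hgi : IntegrableOn g (ball 0 1) := (hi1.add hi2).add hi3
  have hgint : ∫ y in ball (0:ℂ) 1, g y ≤ c₁ * (∫ y in ball p r, -lap u y) +
      c₂ * (∫ y in ball (0:ℂ) 1, -lap u y) + K * (2 * Real.pi * ρ ^ 2) := by
    have e1 : ∫ y in ball (0:ℂ) 1, g y =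
        (∫ y in ball (0:ℂ) 1, (c₁ * (ball p r).indicator (fun y => -lap u y) y + c₂ * -lap u y)) +
        ∫ y in ball (0:ℂ) 1, K * H y := integral_add (hi1.add hi2) hi3
    rw [e1, integral_add hi1 hi2, integral_const_mul, integral_const_mul, integral_const_mul,
      setIntegral_indicator measurableSet_ball, Set.inter_eq_right.2 hrs]
    have : ∫ y in ball (0:ℂ) 1, H y ≤ 2 * Real.pi * ρ ^ 2 := by
      rw [← hH]
      exact setIntegral_le_integral hHi (ae_of_all _ hHnn)
    gcongr
  refine le_trans ?_ hgint
  rw [← ENNReal.ofReal_le_ofReal_iff (setIntegral_nonneg measurableSet_ball hg0),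
    ← (green_representation hu huc hu0 hlap hp).2,
    ofReal_integral_eq_lintegral_ofReal hgi
      ((ae_restrict_iff' measurableSet_ball).2 (ae_of_all _ hg0))]
  exact setLIntegral_mono' measurableSet_ball fun y hy => ENNReal.ofReal_le_ofReal (hle y hy)

/-- Lower bound for the solution at `x` by the mass concentrated in a set on which the Green
function is bounded below. -/
lemma mul_mass_le_two_pi_mul {u : ℂ → ℝ} (hu : ContDiffOn ℝ 2 u (ball 0 1))
    (huc : ContinuousOn u (closedBall 0 1)) (hu0 : ∀ x ∈ sphere (0:ℂ) 1, u x = 0)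
    (hlap : ∀ x ∈ ball (0:ℂ) 1, lap u x ≤ 0)
    (hlapInt : IntegrableOn (fun y => -lap u y) (ball 0 1)) {x : ℂ} (hx : ‖x‖ < 1)
    {A : Set ℂ} (hA : MeasurableSet A) (hAs : A ⊆ ball 0 1) {c : ℝ} (hc : 0 ≤ c)
    (hG : ∀ y ∈ A, c ≤ greenKernel x y) :
    c * (∫ y in A, -lap u y) ≤ 2 * Real.pi * u x := by
  obtain ⟨hux, hrep⟩ := green_representation hu huc hu0 hlap hx
  have hpi := Real.pi_pos
  rw [← ENNReal.ofReal_le_ofReal_iff (by positivity), ← hrep, ← integral_const_mul,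
    ofReal_integral_eq_lintegral_ofReal ((hlapInt.mono_set hAs).const_mul c)
    ((ae_restrict_iff' hA).2 (ae_of_all _ fun y hy => mul_nonneg hc (by linarith [hlap y (hAs hy)])))]
  refine le_trans (setLIntegral_mono' hA fun y hy => ?_) (lintegral_mono_set hAs)
  apply ENNReal.ofReal_le_ofReal
  exact mul_le_mul_of_nonneg_right (hG y hy) (by linarith [hlap y (hAs hy)])

lemma log_div_le_greenKernel {x y : ℂ} (hy : ‖y‖ < 1) (hne : y ≠ x) {d D : ℝ}
    (hd : 0 < d) (hdx : d ≤ 1 - ‖x‖) (hD : ‖y - x‖ ≤ D) :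
    Real.log (d / D) ≤ greenKernel x y := by
  have hs : 0 < ‖y - x‖ := norm_pos_iff.2 (sub_ne_zero.2 hne)
  have hDpos : 0 < D := hs.trans_le hD
  refine Real.log_le_log (by positivity) ?_
  have : d ≤ ‖1 - starRingEnd ℂ x * y‖ := by
    have h1 := norm_sub_norm_le 1 (starRingEnd ℂ x * y)
    rw [norm_one, norm_mul, Complex.norm_conj] at h1
    nlinarith [norm_nonneg x, norm_nonneg y]
  gcongr

section Solution

variable {α : ℝ} {x₀ : ℂ} {b : ℝ} {u V : ℂ → ℝ}

lemma IsSol.neg_lap_nonneg (hsol : IsSol α x₀ V u)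
    (hV : ∀ y ∈ closedBall (0:ℂ) 1, 0 ≤ V y ∧ V y ≤ b) {y : ℂ} (hy : y ∈ ball (0:ℂ) 1) :
    0 ≤ -lap u y := by
  rw [hsol.2.2.1 y hy]
  have := (hV y (ball_subset_closedBall hy)).1
  positivity

lemma IsSol.neg_lap_le (hsol : IsSol α x₀ V u)
    (hV : ∀ y ∈ closedBall (0:ℂ) 1, 0 ≤ V y ∧ V y ≤ b) {y : ℂ} (hy : y ∈ ball (0:ℂ) 1) :
    -lap u y ≤ b * (‖y - x₀‖ ^ (-(2 * α)) * Real.exp (u y)) := by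
  rw [hsol.2.2.1 y hy]
  have h := (hV y (ball_subset_closedBall hy)).2
  have h2 : 0 ≤ ‖y - x₀‖ ^ (-(2 * α)) * Real.exp (u y) := by positivity
  nlinarith

lemma IsSol.integrableOn_weight (hα : α < 1) (hsol : IsSol α x₀ V u) :
    IntegrableOn (fun y => ‖y - x₀‖ ^ (-(2 * α)) * Real.exp (u y)) (ball 0 1) := by
  obtain ⟨B, hB⟩ := (isCompact_closedBall (0:ℂ) 1).exists_bound_of_continuousOn
    hsol.2.1.continuousOn
  refine Integrable.mul_bdd (c := Real.exp B)
    (integrableOn_norm_sub_rpow x₀ (β := 2 * α) (by linarith)) ?_ ?_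
  · exact (Real.continuous_exp.comp_continuousOn hsol.1.continuousOn).aestronglyMeasurable
      measurableSet_ball
  · refine (ae_restrict_iff' measurableSet_ball).2 (ae_of_all _ fun y hy => ?_)
    rw [Real.norm_of_nonneg (Real.exp_pos _).le, Real.exp_le_exp]
    exact (le_abs_self _).trans (hB y (ball_subset_closedBall hy))

lemma IsSol.integrableOn_neg_lap (hα : α < 1) (hsol : IsSol α x₀ V u)
    (hV : ∀ y ∈ closedBall (0:ℂ) 1, 0 ≤ V y ∧ V y ≤ b) :
    IntegrableOn (fun y => -lap u y) (ball 0 1) := by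
  refine Integrable.mono' ((hsol.integrableOn_weight hα).const_mul b)
    ((continuousOn_lap isOpen_ball hsol.1).neg.aestronglyMeasurable measurableSet_ball)
    ((ae_restrict_iff' measurableSet_ball).2 (ae_of_all _ fun y hy => ?_))
  rw [Real.norm_of_nonneg (hsol.neg_lap_nonneg hV hy)]
  exact hsol.neg_lap_le hV hy

lemma IsSol.integral_neg_lap (hsol : IsSol α x₀ V u) :
    ∫ y in ball (0:ℂ) 1, -lap u y =
      ∫ y in ball (0:ℂ) 1, ‖y - x₀‖ ^ (-(2*α)) * V y * Real.exp (u y) :=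
  setIntegral_congr_fun measurableSet_ball fun y hy => hsol.2.2.1 y hy

/-- The maximum is controlled by the scale-invariant quantity
`d(p, ∂B)² |p - x₀|^{-2α} e^{u(p)}`. -/
lemma IsSol.max_le_of_scale (hα : α ∈ Set.Ioo (0:ℝ) (1/2)) (hx₀ : ‖x₀‖ = 1) (hb : 0 < b)
    (hsol : IsSol α x₀ V u) (hV : ∀ y ∈ closedBall (0:ℂ) 1, 0 ≤ V y ∧ V y ≤ b) {m : ℝ}
    (hm : ∫ y in ball (0:ℂ) 1, -lap u y ≤ m) {p : ℂ} (hp : ‖p‖ < 1)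
    (hmax : ∀ y ∈ closedBall (0:ℂ) 1, u y ≤ u p) :
    2 * Real.pi * u p ≤ 2 * Real.log 5 * m + Real.pi * b *
      Real.exp (u p + 2 * Real.log (1 - ‖p‖) - 2 * α * Real.log ‖p - x₀‖) := by
  have hα1 : α < 1 := by linarith [hα.2]
  set d := 1 - ‖p‖ with hd
  have hd0 : 0 < d := by linarith
  have hdx : d ≤ ‖p - x₀‖ := by
    have := norm_sub_norm_le x₀ p
    rw [hx₀, norm_sub_rev] at this
    exact this
  have hpx : 0 < ‖p - x₀‖ := hd0.trans_le hdx
  have hsub : ball p (d / 2) ⊆ ball 0 1 := by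
    intro y hy
    rw [mem_ball_iff_norm] at hy
    rw [mem_ball_zero_iff]
    have := norm_sub_norm_le y p
    linarith
  set W := ‖p - x₀‖ ^ (-(2 * α)) with hW
  have hW0 : 0 < W := Real.rpow_pos_of_pos hpx _
  have hK : ∀ y ∈ ball p (d / 2), -lap u y ≤ b * (2 * W * Real.exp (u p)) := by
    intro y hy
    refine (hsol.neg_lap_le hV (hsub hy)).trans ?_
    have h1 : ‖p - x₀‖ / 2 ≤ ‖y - x₀‖ := by
      rw [mem_ball_iff_norm] at hy
      have h2 : ‖p - x₀‖ ≤ ‖y - x₀‖ + ‖y - p‖ := by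
        have : p - x₀ = (y - x₀) - (y - p) := by ring
        rw [this]
        exact norm_sub_le _ _
      linarith
    have h2 : ‖y - x₀‖ ^ (-(2 * α)) ≤ 2 * W := by
      calc ‖y - x₀‖ ^ (-(2 * α)) ≤ (‖p - x₀‖ / 2) ^ (-(2 * α)) :=
            Real.rpow_le_rpow_of_nonpos (by positivity) h1 (by linarith [hα.1])
        _ = W * 2 ^ (2 * α) := by
            rw [Real.div_rpow hpx.le (by norm_num), Real.rpow_neg (by norm_num : (0:ℝ) ≤ 2),
              div_inv_eq_mul]
        _ ≤ W * 2 ^ (1:ℝ) := by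
            gcongr
            · norm_num
            · linarith [hα.2]
        _ = 2 * W := by rw [Real.rpow_one, mul_comm]
    have h3 := hmax y (ball_subset_closedBall (hsub hy))
    gcongr
  have hlapInt := hsol.integrableOn_neg_lap hα1 hV
  have hup := two_pi_mul_le_of_neg_lap_le hsol.1 hsol.2.1.continuousOn hsol.2.2.2
    (fun y hy => by linarith [hsol.neg_lap_nonneg hV hy]) hlapInt hp (half_pos hd0) le_rfl
    (by positivity) hsub hK
  have h5 : 1 + 2 * (1 - ‖p‖) / (d / 2) = 5 := by
    rw [← hd]
    field_simp
    norm_num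
  have hlog5 : 0 ≤ Real.log 5 := Real.log_nonneg (by norm_num)
  have hA : ∫ y in ball p (d / 2), -lap u y ≤ ∫ y in ball (0:ℂ) 1, -lap u y :=
    setIntegral_mono_set hlapInt ((ae_restrict_iff' measurableSet_ball).2
      (ae_of_all _ fun y hy => hsol.neg_lap_nonneg hV hy)) hsub.eventuallyLE
  have hexp : Real.exp (u p + 2 * Real.log d - 2 * α * Real.log ‖p - x₀‖) =
      Real.exp (u p) * d ^ 2 * W := by
    rw [hW, Real.rpow_def_of_pos hpx, sub_eq_add_neg, Real.exp_add, Real.exp_add, two_mul (Real.log d),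
      Real.exp_add, Real.exp_log hd0]
    ring_nf
  rw [h5] at hup
  rw [hexp]
  have h6 : b * (2 * W * Real.exp (u p)) * (2 * Real.pi * (d / 2) ^ 2) =
      Real.pi * b * (Real.exp (u p) * d ^ 2 * W) := by ring
  rw [h6] at hup
  have h7 := mul_le_mul_of_nonneg_left (hA.trans hm) hlog5
  have h8 := mul_le_mul_of_nonneg_left hm hlog5
  linarith

lemma half_le_rpow_neg_two_mul (hα : α ∈ Set.Ioo (0:ℝ) (1/2)) {t : ℝ} (ht : 0 < t)
    (ht2 : t ≤ 2) : 1 / 2 ≤ t ^ (-(2 * α)) := by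
  calc (1:ℝ) / 2 = 2 ^ (-1 : ℝ) := by rw [Real.rpow_neg_one]; norm_num
    _ ≤ 2 ^ (-(2 * α)) := Real.rpow_le_rpow_of_exponent_le (by norm_num) (by linarith [hα.2])
    _ ≤ _ := Real.rpow_le_rpow_of_nonpos ht ht2 (by linarith [hα.1])

set_option maxHeartbeats 1000000 in
-- The final contradiction combines many estimates in one context.
/-- A solution of bounded mass, with bounded weighted integral of `e^u`, has a bounded maximum
as long as the maximum point stays away from the boundary. -/
lemma IsSol.exists_max_le_of_interior (hα : α ∈ Set.Ioo (0:ℝ) (1/2)) (hx₀ : ‖x₀‖ = 1)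
    (hb : 0 < b) {C m d₀ : ℝ} (hC : 0 < C) (hm0 : 0 ≤ m) (hd₀ : 0 < d₀) :
    ∃ M₀ : ℝ, ∀ u V : ℂ → ℝ, ∀ p : ℂ, IsSol α x₀ V u →
      (∀ y ∈ closedBall (0:ℂ) 1, 0 ≤ V y ∧ V y ≤ b) →
      (∫ y in ball (0:ℂ) 1, ‖y - x₀‖ ^ (-(2*α)) * Real.exp (u y)) ≤ C →
      (∫ y in ball (0:ℂ) 1, -lap u y) ≤ m → ‖p‖ < 1 → d₀ ≤ 1 - ‖p‖ →
      (∀ y ∈ closedBall (0:ℂ) 1, u y ≤ u p) → u p ≤ M₀ := by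
  have hpi := Real.pi_pos
  have hα1 : α < 1 := by linarith [hα.2]
  set a := d₀ / 4 with ha
  have ha0 : 0 < a := by positivity
  set k := 2 * C / (Real.pi * a ^ 2) + 1 with hk
  have hk0 : 0 < k := by positivity
  set r := a * Real.exp (-k) with hr
  have hr0 : 0 < r := by positivity
  have hra : r < a := mul_lt_of_lt_one_right ha0 (Real.exp_lt_one_iff.2 (by linarith))
  have hlogar : Real.log (a / r) = k := by
    rw [hr, div_mul_cancel_left₀ ha0.ne', ← Real.exp_neg, neg_neg, Real.log_exp]
  set b' := b * (d₀ / 2) ^ (-(2 * α)) with hb'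
  have hb'0 : 0 < b' := by positivity
  set c := Real.log 3 * m + Real.log (1 + 2 / r) * m + 2 * Real.pi * b' with hc
  have hlog2 : 0 < Real.log 2 := Real.log_pos (by norm_num)
  have hlog3 : 0 < Real.log 3 := Real.log_pos (by norm_num)
  have hlogr : 0 ≤ Real.log (1 + 2 / r) := Real.log_nonneg (by linarith [div_pos two_pos hr0])
  have hc0 : 0 < c := by positivity
  refine ⟨max (max 1 (-2 * Real.log r)) (c * k / (Real.pi * Real.log 2)), ?_⟩
  intro u V p hsol hV hC1 hm hp hd hmax
  by_contra! hM
  set M := u p with hMdef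
  have hM1 : 1 < M := lt_of_le_of_lt ((le_max_left _ _).trans (le_max_left _ _)) hM
  have hM2 : -2 * Real.log r < M := lt_of_le_of_lt ((le_max_right _ _).trans (le_max_left _ _)) hM
  have hM3 : c * k < M * (Real.pi * Real.log 2) :=
    (div_lt_iff₀ (by positivity)).1 (lt_of_le_of_lt (le_max_right _ _) hM)
  set ρ := Real.exp (-M / 2) with hρ
  have hρ0 : 0 < ρ := Real.exp_pos _
  have hρr : ρ ≤ r := by
    rw [hρ, ← Real.exp_log hr0, Real.exp_le_exp]
    linarith
  have hρ1 : ρ ≤ 1 := Real.exp_le_one_iff.2 (by linarith)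
  have hball : ∀ y ∈ ball p a, ‖y‖ < 1 - 3 * a := by
    intro y hy
    rw [mem_ball_iff_norm] at hy
    have := norm_sub_norm_le y p
    linarith
  have hsuba : ball p a ⊆ ball 0 1 := fun y hy => by
    rw [mem_ball_zero_iff]
    linarith [hball y hy]
  have hsubr : ball p r ⊆ ball 0 1 := (ball_subset_ball hra.le).trans hsuba
  have hlapInt := hsol.integrableOn_neg_lap hα1 hV
  have hlapnp : ∀ y ∈ ball (0:ℂ) 1, lap u y ≤ 0 := fun y hy => by
    linarith [hsol.neg_lap_nonneg hV hy]
  have hK : ∀ y ∈ ball p ρ, -lap u y ≤ b' * Real.exp M := by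
    intro y hy
    have hya : y ∈ ball p a := ball_subset_ball (hρr.trans hra.le) hy
    refine (hsol.neg_lap_le hV (hsuba hya)).trans ?_
    have h1 : d₀ / 2 ≤ ‖y - x₀‖ := by
      have h2 := norm_sub_norm_le x₀ y
      rw [hx₀, norm_sub_rev] at h2
      linarith [hball y hya]
    have h2 : ‖y - x₀‖ ^ (-(2 * α)) ≤ (d₀ / 2) ^ (-(2 * α)) :=
      Real.rpow_le_rpow_of_nonpos (by positivity) h1 (by linarith [hα.1])
    have h3 : u y ≤ M := hmax y (ball_subset_closedBall (hsuba hya))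
    rw [hb', mul_assoc]
    gcongr
  set A := ∫ y in ball p r, -lap u y with hA
  have hA0 : 0 ≤ A := setIntegral_nonneg measurableSet_ball fun y hy =>
    hsol.neg_lap_nonneg hV (hsubr hy)
  have hAm : A ≤ m := le_trans (setIntegral_mono_set hlapInt ((ae_restrict_iff' measurableSet_ball).2
    (ae_of_all _ fun y hy => hsol.neg_lap_nonneg hV hy)) hsubr.eventuallyLE) hm
  have hup := two_pi_mul_le_of_neg_lap_le hsol.1 hsol.2.1.continuousOn hsol.2.2.2
    hlapnp hlapInt hp hρ0 hρr (by positivity) hsubr hK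
  have hlog1 : Real.log (1 + 2 * (1 - ‖p‖) / ρ) ≤ Real.log 3 + M / 2 := by
    have h1 : 1 + 2 * (1 - ‖p‖) / ρ ≤ 3 / ρ := by
      rw [← sub_nonneg]
      have : 3 / ρ - (1 + 2 * (1 - ‖p‖) / ρ) = (3 - ρ - 2 * (1 - ‖p‖)) / ρ := by
        field_simp
        ring
      rw [this]
      exact div_nonneg (by linarith [norm_nonneg p]) hρ0.le
    have h2 := Real.log_le_log (by linarith [div_pos (by linarith : 0 < 2 * (1 - ‖p‖)) hρ0]) h1
    rw [Real.log_div (by norm_num) hρ0.ne', hρ, Real.log_exp] at h2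
    linarith
  have hlog2' : Real.log (1 + 2 * (1 - ‖p‖) / r) ≤ Real.log (1 + 2 / r) := by
    apply Real.log_le_log (by linarith [div_pos (by linarith : 0 < 2 * (1 - ‖p‖)) hr0])
    gcongr
    linarith [norm_nonneg p]
  have hρsq : b' * Real.exp M * (2 * Real.pi * ρ ^ 2) = 2 * Real.pi * b' := by
    have : Real.exp M * ρ ^ 2 = 1 := by
      rw [hρ, ← Real.exp_nat_mul, ← Real.exp_add]
      simp
      ring
    linear_combination 2 * Real.pi * b' * this
  rw [hρsq] at hup
  have hmassineq : 2 * Real.pi * M ≤ M / 2 * A + c := by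
    have hI0 : 0 ≤ ∫ y in ball (0:ℂ) 1, -lap u y := setIntegral_nonneg measurableSet_ball
      fun y hy => hsol.neg_lap_nonneg hV hy
    have e1 := mul_le_mul_of_nonneg_right hlog1 hA0
    have e2 := mul_le_mul_of_nonneg_right hlog2' hI0
    have e3 := mul_le_mul_of_nonneg_left hm hlogr
    have e4 := mul_le_mul_of_nonneg_left hAm hlog3.le
    linarith
  have hlower : ∀ y : ℂ, ‖y - p‖ ∈ Set.Ico r a → (a / ‖y - p‖) ^ 2 / 2 ≤ Real.exp (u y) := by
    intro y hy
    have hs0 : 0 < ‖y - p‖ := hr0.trans_le hy.1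
    have hyn := hball y (mem_ball_iff_norm.2 hy.2)
    set l := Real.log (a / ‖y - p‖) with hl
    have hl0 : 0 ≤ l := Real.log_nonneg ((one_le_div hs0).2 hy.2.le)
    have hlk : l ≤ k := by
      rw [← hlogar]
      apply Real.log_le_log (by positivity)
      exact div_le_div_of_nonneg_left ha0.le hr0 hy.1
    have h1 : l * A ≤ 2 * Real.pi * u y := by
      refine mul_mass_le_two_pi_mul hsol.1 hsol.2.1.continuousOn hsol.2.2.2 hlapnp hlapInt
        (by linarith) measurableSet_ball hsubr hl0 fun z hz => ?_
      have hz' := mem_ball_iff_norm.1 hz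
      have h2 := log_div_le_greenKernel (x := y) (y := z) (d := 2 * a) (D := 2 * ‖y - p‖)
        (mem_ball_zero_iff.1 (hsubr hz)) (by
          rintro rfl
          linarith [hy.1]) (by positivity) (by linarith) (by
          have : z - y = (z - p) - (y - p) := by ring
          rw [this]
          refine (norm_sub_le _ _).trans ?_
          linarith [hy.1])
      rwa [mul_div_mul_left _ _ two_ne_zero] at h2
    have h2 : 2 * l - Real.log 2 ≤ u y := by
      have e1 : M * (l * A) ≤ M * (2 * Real.pi * u y) :=
        mul_le_mul_of_nonneg_left h1 (by linarith)
      have e2 := mul_le_mul_of_nonneg_left hmassineq hl0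
      have e3 := mul_le_mul_of_nonneg_left hlk hc0.le
      have e4 : (Real.pi * M) * (2 * l - Real.log 2) ≤ (Real.pi * M) * u y := by linarith
      exact le_of_mul_le_mul_left e4 (by positivity)
    have h3 := Real.exp_le_exp.2 h2
    rwa [Real.exp_sub, Real.exp_log two_pos, two_mul, Real.exp_add, hl,
      Real.exp_log (by positivity), ← sq] at h3
  obtain ⟨hIi, hI⟩ := integral_inv_dist_sq_annulus p hr0 hra.le
  set I : ℂ → ℝ := fun y => (Set.Ico r a).indicator (fun s => (a / s) ^ 2) ‖y - p‖ with hIdef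
  have hpt : ∀ y ∈ ball (0:ℂ) 1, I y / 4 ≤ ‖y - x₀‖ ^ (-(2*α)) * Real.exp (u y) := by
    intro y hy
    by_cases h : ‖y - p‖ ∈ Set.Ico r a
    · simp only [hIdef, Set.indicator_of_mem h]
      have h1 := hlower y h
      have hyn := hball y (mem_ball_iff_norm.2 h.2)
      have hpos : 0 < ‖y - x₀‖ := by
        have h2 := norm_sub_norm_le x₀ y
        rw [hx₀, norm_sub_rev] at h2
        linarith
      have h2 : ‖y - x₀‖ ≤ 2 := (norm_sub_le _ _).trans (by
        rw [hx₀]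
        linarith)
      have h3 := half_le_rpow_neg_two_mul hα hpos h2
      calc (a / ‖y - p‖) ^ 2 / 4 = 1 / 2 * ((a / ‖y - p‖) ^ 2 / 2) := by ring
        _ ≤ _ := by gcongr
    · simp only [hIdef, Set.indicator_of_notMem h, zero_div]
      positivity
  have hle : ∫ y in ball (0:ℂ) 1, I y / 4 ≤ C :=
    (setIntegral_mono_on (hIi.integrableOn.div_const 4) (hsol.integrableOn_weight hα1)
      measurableSet_ball hpt).trans hC1
  rw [setIntegral_eq_integral_of_forall_compl_eq_zero, integral_div, hI, hlogar] at hle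
  · have : 2 * Real.pi * (a ^ 2 * k) / 4 = C + Real.pi * a ^ 2 / 2 := by
      rw [hk]
      field_simp
      ring
    have h2 : 0 < Real.pi * a ^ 2 / 2 := by positivity
    linarith
  · intro y hy
    have : ‖y - p‖ ∉ Set.Ico r a := fun h => hy (hsuba (mem_ball_iff_norm.2 h.2))
    simp only [hIdef, Set.indicator_of_notMem this, zero_div]

end Solution

/-- At a blow-up, the distance to the boundary tends to `0` and
`u_i(x_i) + 2 log δ_i - 2α log |x_i - x₀| → +∞`. -/
theorem blowup_boundary_estimate
    (α : ℝ) (hα : α ∈ Set.Ioo (0:ℝ) (1/2)) (x₀ : ℂ) (hx₀ : ‖x₀‖ = 1)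
    (b C ε : ℝ) (hb : 0 < b) (hC : 0 < C) (hε : 0 < ε)
    (u V : ℕ → ℂ → ℝ) (x : ℕ → ℂ) (δ : ℕ → ℝ)
    (hsol : ∀ i, IsSol α x₀ (V i) (u i))
    (hV : ∀ i, ∀ y ∈ closedBall (0:ℂ) 1, 0 ≤ V i y ∧ V i y ≤ b)
    (hint1 : ∀ i, (∫ y in ball (0:ℂ) 1, ‖y - x₀‖ ^ (-(2*α)) * Real.exp (u i y)) ≤ C)
    (hint2 : ∀ i, (∫ y in ball (0:ℂ) 1,
        ‖y - x₀‖ ^ (-(2*α)) * V i y * Real.exp (u i y)) ≤ 16 * Real.pi - ε)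
    (hx : ∀ i, x i ∈ ball (0:ℂ) 1)
    (hmax : ∀ i, ∀ y ∈ closedBall (0:ℂ) 1, u i y ≤ u i (x i))
    (hblow : Tendsto (fun i => u i (x i)) atTop atTop)
    (hδ : ∀ i, δ i = 1 - ‖x i‖) :
    Tendsto δ atTop (nhds 0) ∧
    Tendsto (fun i => u i (x i) + 2 * Real.log (δ i) - 2 * α * Real.log ‖x i - x₀‖)
      atTop atTop := by
  have hm : ∀ i, (∫ y in ball (0:ℂ) 1, -lap (u i) y) ≤ 16 * Real.pi := fun i => by
    rw [(hsol i).integral_neg_lap]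
    linarith [hint2 i]
  have hpi := Real.pi_pos
  have hx' : ∀ i, ‖x i‖ < 1 := fun i => mem_ball_zero_iff.1 (hx i)
  constructor
  · rw [tendsto_order]
    refine ⟨fun a ha => Eventually.of_forall fun i => ?_, fun d₀ hd₀ => ?_⟩
    · rw [hδ]
      linarith [hx' i]
    · obtain ⟨M₀, hM₀⟩ := IsSol.exists_max_le_of_interior hα hx₀ hb hC
        (by positivity : 0 ≤ 16 * Real.pi) hd₀
      filter_upwards [hblow.eventually_gt_atTop M₀] with i hi
      by_contra! h
      rw [hδ] at h
      exact absurd (hM₀ (u i) (V i) (x i) (hsol i) (hV i) (hint1 i) (hm i) (hx' i) h (hmax i))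
        (not_le.2 hi)
  · rw [← Real.tendsto_exp_comp_atTop]
    have hlow : Tendsto (fun i => (2 * Real.pi * u i (x i) - 2 * Real.log 5 * (16 * Real.pi)) /
        (Real.pi * b)) atTop atTop := by
      refine Tendsto.atTop_div_const (by positivity) ?_
      exact tendsto_atTop_add_const_right _ _ (hblow.const_mul_atTop (by positivity))
    refine tendsto_atTop_mono (fun i => ?_) hlow
    rw [div_le_iff₀ (by positivity), hδ]
    linarith [(hsol i).max_le_of_scale hα hx₀ hb (hV i) (hm i) (hx' i) (hmax i)]
end

section
/- (Geometric core of Lemma 2.2) Let B₁(0) be the open unit ball of ℝ², let x ∈ B₁(0) with δ = d(x, ∂B₁(0)) > 0, let ε > 0, and let t ∈ B₁(0) be a point with d(t, ∂B(x, δε)) ≥ δε, where B(x, δε) is the open ball of center x and radius δε. Set δ' = min( d(t, ∂B(x, δε)), d(t, ∂B₁(0)) ). Then δ' ≤ d(t, ∂B₁(0)) ≤ (2 + 1/ε) δ'. -/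
open Metric

/-- The distance to the center of a sphere is at most the distance to the sphere plus its radius. -/
theorem dist_le_infDist_sphere_add {E : Type*} [PseudoMetricSpace E] {c t : E} {r : ℝ}
    (hne : (sphere c r).Nonempty) : dist t c ≤ infDist t (sphere c r) + r := by
  have h : dist t c - r ≤ infDist t (sphere c r) := by
    refine (le_infDist hne).2 fun y hy => ?_
    have h₁ := dist_triangle t y c
    rw [mem_sphere.1 hy] at h₁
    linarith
  linarith

/-- Geometric core of Lemma 2.2: if `t` lies at distance at least `δε` from the
sphere `∂B(x, δε)`, then `δ' = min(d(t, ∂B(x,δε)), d(t, ∂B₁(0)))` is comparable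
to `d(t, ∂B₁(0))`: `δ' ≤ d(t, ∂B₁(0)) ≤ (2 + 1/ε) δ'`. -/
theorem dist_to_boundary_comparable
    (x t : ℂ) (hx : x ∈ ball (0:ℂ) 1) (ht : t ∈ ball (0:ℂ) 1)
    (δ ε : ℝ) (hδ : δ = infDist x (sphere (0:ℂ) 1)) (hδpos : 0 < δ) (hε : 0 < ε)
    (hfar : δ * ε ≤ infDist t (sphere x (δ * ε))) :
    min (infDist t (sphere x (δ * ε))) (infDist t (sphere (0:ℂ) 1))
        ≤ infDist t (sphere (0:ℂ) 1) ∧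
      infDist t (sphere (0:ℂ) 1)
        ≤ (2 + 1/ε) *
          min (infDist t (sphere x (δ * ε))) (infDist t (sphere (0:ℂ) 1)) := by
  refine ⟨min_le_right _ _, ?_⟩
  have hne : (sphere x (δ * ε)).Nonempty := NormedSpace.sphere_nonempty.2 (by positivity)
  have hcenter := dist_le_infDist_sphere_add (t := t) hne
  have htri : infDist t (sphere (0:ℂ) 1) ≤ infDist x (sphere (0:ℂ) 1) + dist t x :=
    infDist_le_infDist_add_dist
  rw [← hδ] at htri
  have hδle : δ ≤ 1 / ε * infDist t (sphere x (δ * ε)) := by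
    rw [one_div_mul_eq_div]
    exact (le_div_iff₀ hε).2 hfar
  have hinv : 0 < 1 / ε := by positivity
  have hnonneg : 0 ≤ infDist t (sphere (0:ℂ) 1) := infDist_nonneg
  rcases min_choice (infDist t (sphere x (δ * ε))) (infDist t (sphere (0:ℂ) 1)) with h | h
  · rw [h]
    linarith
  · rw [h]
    nlinarith
end
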